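/- (Intensity of a mixed point process.) Let X be a measurable space, let N be a probability measure on ℕ, and let ν be a probability measure on X. Define the point process π on X as π = N.bind (fun n => (K_n)_*(⊗_{i : Fin n} ν)), the process that samples a count n from N and then places n points independently according to ν. Then the intensity measure of π satisfies, for every measurable U ⊆ X: 𝔼(π)(U) = (∫⁻ n, n dN) · ν(U). In particular, when N is the Poisson distribution with mean Λ and ν is the uniform distribution on the unit square, 𝔼(π)(W) = Λ · |W| for every measurable W, where |W| is the Lebesgue measure (area) of W. -/

import Mathlib

open MeasureTheory
open scoped ENNReal NNReal

/-- `bagA U k` is the set `A^U_k` of bags with exactly `k` elements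
(counted with multiplicity) lying in `U`. -/
def bagA {X : Type*} (U : Set X) (k : ℕ) : Set (Multiset X) :=
  {b | @Multiset.countP X (· ∈ U) (Classical.decPred _) b = k}

/-- The bag σ-algebra on `Multiset X`, generated by the sets `A^U_k`
for `U` measurable and `k : ℕ`. -/
instance bagMeasurableSpace (X : Type*) [MeasurableSpace X] : MeasurableSpace (Multiset X) :=
  MeasurableSpace.generateFrom {A | ∃ (U : Set X) (k : ℕ), MeasurableSet U ∧ A = bagA U k}

/-- `iB` sends a bag to its counting measure, the multiplicity-respecting
sum of Dirac measures at its elements. -/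
noncomputable def iB {X : Type*} [MeasurableSpace X] (b : Multiset X) : Measure X :=
  (b.map Measure.dirac).sum

/-- `bagK n` sends an `n`-tuple to the bag of its components. -/
def bagK {X : Type*} (n : ℕ) (x : Fin n → X) : Multiset X :=
  (List.ofFn x : List X)

/-- The counting measure of a bag counts the points lying in a measurable set. -/
theorem iB_apply {X : Type*} [MeasurableSpace X] {U : Set X} (hU : MeasurableSet U)
    (b : Multiset X) :
    iB b U = (@Multiset.countP X (· ∈ U) (Classical.decPred _) b : ℝ≥0∞) := by
  classical
  induction b using Multiset.induction_on with
  | empty => simp [iB]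
  | cons a s ih =>
    have hcons : iB (a ::ₘ s) = Measure.dirac a + iB s := by simp [iB]
    rw [hcons, Measure.add_apply, ih, Measure.dirac_apply' a hU, Multiset.countP_cons]
    by_cases ha : a ∈ U <;> simp [ha, add_comm]

theorem bagA_eq_preimage_iB {X : Type*} [MeasurableSpace X] {U : Set X} (hU : MeasurableSet U)
    (k : ℕ) : bagA U k = (fun b => iB b U) ⁻¹' {(k : ℝ≥0∞)} := by
  ext b
  simp [bagA, iB_apply hU]

theorem measurable_iB {X : Type*} [MeasurableSpace X] :
    Measurable (iB : Multiset X → Measure X) := by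
  refine Measure.measurable_of_measurable_coe _ fun U hU => ?_
  simp_rw [iB_apply hU]
  refine (measurable_of_countable (Nat.cast : ℕ → ℝ≥0∞)).comp
    (measurable_to_countable' fun k => ?_)
  exact MeasurableSpace.measurableSet_generateFrom ⟨U, k, hU, rfl⟩

theorem measurable_iB_apply {X : Type*} [MeasurableSpace X] {U : Set X} (hU : MeasurableSet U) :
    Measurable fun b : Multiset X => iB b U :=
  (Measure.measurable_coe hU).comp measurable_iB

theorem measurable_dirac_eval_apply {ι X : Type*} [MeasurableSpace X] {U : Set X}
    (hU : MeasurableSet U) (i : ι) : Measurable fun x : ι → X => Measure.dirac (x i) U :=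
  (Measure.measurable_coe hU).comp (Measure.measurable_dirac.comp (measurable_pi_apply i))

theorem iB_bagK {X : Type*} [MeasurableSpace X] (n : ℕ) (x : Fin n → X) :
    iB (bagK n x) = ∑ i, Measure.dirac (x i) := by
  simp [iB, bagK, List.map_ofFn, List.sum_ofFn]

theorem measurable_bagK {X : Type*} [MeasurableSpace X] (n : ℕ) :
    Measurable (bagK n : (Fin n → X) → Multiset X) := by
  refine measurable_generateFrom ?_
  rintro _ ⟨U, k, hU, rfl⟩
  have hcount : Measurable fun x : Fin n → X => iB (bagK n x) U := by
    simp_rw [iB_bagK, Measure.finsetSum_apply]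
    exact Finset.measurable_sum _ fun i _ => measurable_dirac_eval_apply hU i
  rw [bagA_eq_preimage_iB hU]
  exact hcount (measurableSet_singleton _)

/-- The expected number of points of `n` independent samples from `ν` lying in `U`. -/
theorem lintegral_iB_map_bagK {X : Type*} [MeasurableSpace X] (ν : Measure X)
    [IsProbabilityMeasure ν] {U : Set X} (hU : MeasurableSet U) (n : ℕ) :
    ∫⁻ b, iB b U ∂(Measure.map (bagK n) (Measure.pi fun _ : Fin n => ν)) = n * ν U := by
  rw [lintegral_map (measurable_iB_apply hU) (measurable_bagK n)]
  simp_rw [iB_bagK, Measure.finsetSum_apply]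
  rw [lintegral_finsetSum _ fun i _ => measurable_dirac_eval_apply hU i]
  have heval (i : Fin n) :
      ∫⁻ x : Fin n → X, Measure.dirac (x i) U ∂(Measure.pi fun _ : Fin n => ν) = ν U := by
    rw [(measurePreserving_eval (fun _ : Fin n => ν) i).lintegral_comp
      (f := fun y => Measure.dirac y U)
      ((Measure.measurable_coe hU).comp Measure.measurable_dirac)]
    simp [Measure.dirac_apply' _ hU, lintegral_indicator_one hU]
  simp [heval]

theorem join_map_iB_mixed_apply {X : Type*} [MeasurableSpace X] (N : Measure ℕ) (ν : Measure X)
    [IsProbabilityMeasure ν] {U : Set X} (hU : MeasurableSet U) :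
    Measure.join ((N.bind fun n =>
        Measure.map (bagK n) (Measure.pi fun _ : Fin n => ν)).map iB) U
      = (∫⁻ n, (n : ℝ≥0∞) ∂N) * ν U := by
  rw [Measure.join_apply hU, lintegral_map (Measure.measurable_coe hU) measurable_iB,
    Measure.lintegral_bind (measurable_of_countable _).aemeasurable (measurable_iB_apply hU).aemeasurable]
  simp_rw [lintegral_iB_map_bagK ν hU]
  exact lintegral_mul_const _ (measurable_of_countable _)

theorem poissonPMF_succ_mul (Λ : ℝ≥0) (n : ℕ) :
    ((n + 1 : ℕ) : ℝ≥0∞) * ProbabilityTheory.poissonPMF Λ (n + 1)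
      = Λ * ProbabilityTheory.poissonPMF Λ n := by
  rw [← ProbabilityTheory.poissonPMFReal_ofReal_eq_poissonPMF,
    ← ProbabilityTheory.poissonPMFReal_ofReal_eq_poissonPMF, ← ENNReal.ofReal_natCast,
    ← ENNReal.ofReal_coe_nnreal, ← ENNReal.ofReal_mul (Nat.cast_nonneg _),
    ← ENNReal.ofReal_mul Λ.coe_nonneg]
  congr 1
  simp only [ProbabilityTheory.poissonPMFReal, Nat.factorial_succ, Nat.cast_mul]
  have : (n.factorial : ℝ) ≠ 0 := by positivity
  have : ((n + 1 : ℕ) : ℝ) ≠ 0 := by positivity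
  field_simp
  ring

/-- The mean of the Poisson distribution with parameter `Λ` is `Λ`. -/
theorem lintegral_natCast_poissonPMF (Λ : ℝ≥0) :
    ∫⁻ n, (n : ℝ≥0∞) ∂(ProbabilityTheory.poissonPMF Λ).toMeasure = Λ := by
  rw [lintegral_countable']
  simp_rw [PMF.toMeasure_apply_singleton _ _ (measurableSet_singleton _)]
  rw [tsum_eq_zero_add' ENNReal.summable]
  simp_rw [poissonPMF_succ_mul]
  rw [ENNReal.tsum_mul_left, PMF.tsum_coe]
  simp

theorem isProbabilityMeasure_volume_restrict_unitSquare :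
    IsProbabilityMeasure ((volume : Measure (ℝ × ℝ)).restrict
      (Set.Icc (0 : ℝ) 1 ×ˢ Set.Icc (0 : ℝ) 1)) := by
  constructor
  rw [Measure.restrict_apply_univ, Measure.volume_eq_prod, Measure.prod_prod]
  simp

/-- Intensity of a mixed point process: sampling a count `n` from `N` and placing
`n` i.i.d. points from `ν` yields a point process whose intensity measure of `U` is
`(∫⁻ n dN) · ν(U)`. In particular, for `N` Poisson with mean `Λ` and `ν` uniform on
the unit square, the intensity of a measurable `W` contained in the square is
`Λ · |W|` with `|W|` the Lebesgue measure of `W`. -/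
theorem intensity_mixed {X : Type*} [MeasurableSpace X] (N : Measure ℕ) [IsProbabilityMeasure N]
    (ν : Measure X) [IsProbabilityMeasure ν] :
    (∀ U : Set X, MeasurableSet U →
      Measure.join ((N.bind fun n =>
          Measure.map (bagK n) (Measure.pi fun _ : Fin n => ν)).map iB) U
        = (∫⁻ n, (n : ℝ≥0∞) ∂N) * ν U) ∧
    (∀ (Λ : ℝ≥0) (W : Set (ℝ × ℝ)), MeasurableSet W →
      W ⊆ Set.Icc (0 : ℝ) 1 ×ˢ Set.Icc (0 : ℝ) 1 →
      Measure.join (((ProbabilityTheory.poissonPMF Λ).toMeasure.bind fun n =>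
          Measure.map (bagK n) (Measure.pi fun _ : Fin n =>
            MeasureTheory.volume.restrict (Set.Icc (0 : ℝ) 1 ×ˢ Set.Icc (0 : ℝ) 1))).map iB) W
        = Λ * MeasureTheory.volume W) := by
  refine ⟨fun U hU => join_map_iB_mixed_apply N ν hU, fun Λ W hW hWsub => ?_⟩
  have := isProbabilityMeasure_volume_restrict_unitSquare
  rw [join_map_iB_mixed_apply _ _ hW, lintegral_natCast_poissonPMF, Measure.restrict_apply hW,
    Set.inter_eq_left.mpr hWsub]
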